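/- arXiv:2511.21341 — 3 statements merged into one kernel-verified Lean document; each statement's English description precedes it below -/
import Mathlib

section
/- Let a, b be nonzero integers such that one of a, b is congruent to 1 and the other to 2 modulo 3, and let g = gcd(a, b). Then the zero set of the mask polynomial M_D(ξ) = (1/3)(1 + e^{−2πiaξ} + e^{−2πibξ}) of D = {0, a, b} is exactly { m/(3g) : m ∈ ℤ, 3 ∤ m }. -/
open MeasureTheory Filter Set

/-- The mask polynomial `M_D(ξ) = (1/3)(1 + e^{-2πiaξ} + e^{-2πibξ})` of the digit
set `D = {0, a, b}`. -/
noncomputable def maskPoly (a b : ℤ) (ξ : ℝ) : ℂ :=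
  (1/3 : ℂ) * (1 + Complex.exp ((((-2) * Real.pi * (a : ℝ) * ξ : ℝ) : ℂ) * Complex.I)
    + Complex.exp ((((-2) * Real.pi * (b : ℝ) * ξ : ℝ) : ℂ) * Complex.I))

lemma maskE_eq_one_iff (t : ℝ) :
    Complex.exp (((-2 * Real.pi * t : ℝ) : ℂ) * Complex.I) = 1 ↔ ∃ n : ℤ, t = n := by
  rw [Complex.exp_eq_one_iff]
  have hpi : (Real.pi : ℂ) ≠ 0 := by exact_mod_cast Real.pi_ne_zero
  have key : ∀ n : ℤ, (((-2 * Real.pi * t : ℝ) : ℂ) * Complex.I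
      = n * (2 * Real.pi * Complex.I)) ↔ t = ((-n : ℤ) : ℝ) := by
    intro n
    have h2 : (2 * Real.pi * Complex.I : ℂ) ≠ 0 := Complex.two_pi_I_ne_zero
    constructor
    · intro h
      have h3 : (2 * Real.pi * Complex.I : ℂ) * ((t : ℂ) + n) = 0 := by
        push_cast at h
        linear_combination -h
      have h4 := (mul_eq_zero.mp h3).resolve_left h2
      have h5 : t + n = 0 := by exact_mod_cast h4
      push_cast
      linarith
    · intro h
      rw [h]
      push_cast
      ring
  constructor
  · rintro ⟨n, hn⟩
    exact ⟨-n, (key n).1 hn⟩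
  · rintro ⟨n, hn⟩
    exact ⟨-n, (key (-n)).2 (by simpa using hn)⟩

lemma maskE_add (s t : ℝ) :
    Complex.exp (((-2 * Real.pi * (s + t) : ℝ) : ℂ) * Complex.I) =
    Complex.exp (((-2 * Real.pi * s : ℝ) : ℂ) * Complex.I) *
    Complex.exp (((-2 * Real.pi * t : ℝ) : ℂ) * Complex.I) := by
  rw [← Complex.exp_add]
  congr 1
  push_cast
  ring

/-- The mask polynomial vanishes iff both exponentials are the two primitive cube roots of 1. -/
lemma maskPoly_zero_iff (a b : ℤ) (ξ : ℝ) : maskPoly a b ξ = 0 ↔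
    (∃ n : ℤ, 3 * (a * ξ) = n) ∧ (∃ n : ℤ, a * ξ + b * ξ = n) ∧ ¬ ∃ n : ℤ, a * ξ = n := by
  have e3 : (3 * (a * ξ) : ℝ) = a * ξ + (a * ξ + a * ξ) := by ring
  rw [← maskE_eq_one_iff, ← maskE_eq_one_iff, ← maskE_eq_one_iff, e3, maskE_add, maskE_add,
    maskE_add]
  unfold maskPoly
  rw [mul_assoc (-2 * Real.pi) (a : ℝ), mul_assoc (-2 * Real.pi) (b : ℝ)]
  have hu : ‖Complex.exp (((-2 * Real.pi * (a * ξ) : ℝ) : ℂ) * Complex.I)‖ = 1 :=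
    Complex.norm_exp_ofReal_mul_I _
  have hv : ‖Complex.exp (((-2 * Real.pi * (b * ξ) : ℝ) : ℂ) * Complex.I)‖ = 1 :=
    Complex.norm_exp_ofReal_mul_I _
  generalize Complex.exp (((-2 * Real.pi * (a * ξ) : ℝ) : ℂ) * Complex.I) = u at *
  generalize Complex.exp (((-2 * Real.pi * (b * ξ) : ℝ) : ℂ) * Complex.I) = v at *
  have cu : u * (starRingEnd ℂ) u = 1 := by rw [Complex.mul_conj']; simp [hu]
  have cv : v * (starRingEnd ℂ) v = 1 := by rw [Complex.mul_conj']; simp [hv]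
  constructor
  · intro h
    have h1 : 1 + u + v = 0 := by linear_combination 3 * h
    have h2 : 1 + (starRingEnd ℂ) u + (starRingEnd ℂ) v = 0 := by
      simpa using congrArg (starRingEnd ℂ) h1
    have huv : u * v = 1 := by
      linear_combination (u * v) * h2 - v * cu - u * cv - h1
    have hq : u * u + u + 1 = 0 := by linear_combination u * h1 - huv
    refine ⟨by linear_combination (u - 1) * hq, huv, ?_⟩
    rintro rfl
    norm_num at hq
  · rintro ⟨h3, huv, h1⟩
    have hq : u * u + u + 1 = 0 := by
      have : (u - 1) * (u * u + u + 1) = 0 := by linear_combination h3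
      exact (mul_eq_zero.mp this).resolve_left (sub_ne_zero.mpr h1)
    linear_combination (1/3) * v * hq - (1/3) * (u + 1) * huv + (1/3 : ℂ) * 0

/-- The zero set of the mask polynomial of `{0,a,b}` with `{a,b} ≡ {1,2} (mod 3)`
is exactly `{ m/(3 gcd(a,b)) : m ∈ ℤ, 3 ∤ m }`. -/
theorem zero_set_maskPoly (a b : ℤ) (ha : a ≠ 0) (hb : b ≠ 0)
    (hmod : (a ≡ 1 [ZMOD 3] ∧ b ≡ 2 [ZMOD 3]) ∨ (a ≡ 2 [ZMOD 3] ∧ b ≡ 1 [ZMOD 3])) :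
    {ξ : ℝ | maskPoly a b ξ = 0} =
      {x : ℝ | ∃ m : ℤ, ¬ (3 ∣ m) ∧ x = (m : ℝ) / (3 * (Int.gcd a b : ℝ))} := by
  ext ξ
  simp only [Set.mem_setOf_eq]
  rw [maskPoly_zero_iff]
  have hg0 : Int.gcd a b ≠ 0 := fun h => ha (Int.gcd_eq_zero_iff.mp h).1
  have hgR : (Int.gcd a b : ℝ) ≠ 0 := by exact_mod_cast hg0
  obtain ⟨a', ha'⟩ : (Int.gcd a b : ℤ) ∣ a := Int.gcd_dvd_left ..
  obtain ⟨b', hb'⟩ : (Int.gcd a b : ℤ) ∣ b := Int.gcd_dvd_right ..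
  have hbez := Int.gcd_eq_gcd_ab a b
  generalize Int.gcdA a b = x at hbez
  generalize Int.gcdB a b = y at hbez
  generalize Int.gcd a b = g at *
  have haR : (a : ℝ) = g * a' := by exact_mod_cast ha'
  have hbR : (b : ℝ) = g * b' := by exact_mod_cast hb'
  have hbezR : (g : ℝ) = a * x + b * y := by exact_mod_cast hbez
  have hp3 : Prime (3 : ℤ) := Int.prime_three
  have h3a : ¬ (3 : ℤ) ∣ a := by
    rcases hmod with ⟨h, _⟩ | ⟨h, _⟩ <;> (unfold Int.ModEq at h; omega)
  have h3ab : (3 : ℤ) ∣ a + b := by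
    rcases hmod with ⟨h, h'⟩ | ⟨h, h'⟩ <;> (unfold Int.ModEq at h h'; omega)
  have h3g : ¬ (3 : ℤ) ∣ g := fun h => h3a (ha' ▸ h.mul_right _)
  have h3a' : ¬ (3 : ℤ) ∣ a' := fun h => h3a (ha' ▸ h.mul_left _)
  have h3s : (3 : ℤ) ∣ a' + b' := by
    have : (3 : ℤ) ∣ g * (a' + b') := by rw [mul_add, ← ha', ← hb']; exact h3ab
    exact (hp3.dvd_or_dvd this).resolve_left h3g
  constructor
  · rintro ⟨⟨k, hk⟩, ⟨l, hl⟩, hn⟩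
    have hm : 3 * (g : ℝ) * ξ = ((k * x + (3 * l - k) * y : ℤ) : ℝ) := by
      push_cast
      rw [hbezR, ← hk, ← hl]
      ring
    refine ⟨k * x + (3 * l - k) * y, ?_, ?_⟩
    · rintro ⟨q, hq⟩
      apply hn
      refine ⟨q * a', ?_⟩
      rw [hq] at hm
      push_cast at hm ⊢
      rw [haR]
      linear_combination (a' / 3 : ℝ) * hm
    · rw [← hm]
      field_simp
  · rintro ⟨m, hm, rfl⟩
    obtain ⟨s, hs⟩ := h3s
    have hsR : (a' : ℝ) + b' = 3 * s := by exact_mod_cast hs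
    have hx : (a : ℝ) * (m / (3 * g)) = a' * m / 3 := by
      rw [haR]; field_simp
    have hy : (b : ℝ) * (m / (3 * g)) = b' * m / 3 := by
      rw [hbR]; field_simp
    rw [hx, hy]
    refine ⟨⟨a' * m, by push_cast; ring⟩, ⟨s * m, ?_⟩, ?_⟩
    · push_cast
      linear_combination (m / 3 : ℝ) * hsR
    · rintro ⟨n, hn⟩
      have h1 : (a' : ℝ) * m = 3 * n := by linarith
      have h2 : a' * m = 3 * n := by exact_mod_cast h1
      rcases hp3.dvd_or_dvd (Dvd.intro n h2.symm) with h | h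
      · exact h3a' h
      · exact hm h
end

section
/- Let α and β be coprime positive integers with α > β > 1. Then there exists a sequence (q_n)_{n≥1} of natural numbers such that for every n ≥ 1 and every real x ∈ [1, α/β], the number of indices j with 0 ≤ j ≤ q_n + 1 and ‖(α/β)^j x‖ ≥ 1/(αβ) is at least n, where ‖y‖ = dist(y, ℤ) denotes the distance from y to the nearest integer. -/
/-- `‖y‖ = dist(y, ℤ)`, the distance from `y` to the nearest integer. -/
noncomputable def nint (y : ℝ) : ℝ := |y - round y|

theorem aux_step (α β : ℕ) (hβ : 1 < β) (hαβ : β < α) (y z : ℝ)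
    (hz : (β : ℝ) * z = α * y)
    (h1 : nint y < 1 / ((α : ℝ) * (β : ℝ))) (h2 : nint z < 1 / ((α : ℝ) * (β : ℝ))) :
    (α : ℤ) * round y = β * round z := by
  unfold nint at h1 h2
  have hb : (2 : ℝ) ≤ β := by exact_mod_cast hβ
  have ha : (3 : ℝ) ≤ α := by
    have : 3 ≤ α := by omega
    exact_mod_cast this
  have hc : 0 < (α : ℝ) * β := by positivity
  rw [lt_div_iff₀ hc] at h1 h2
  have e1 : |(α : ℝ) * (y - round y)| * β < 1 := by
    rw [abs_mul, abs_of_nonneg (by positivity : (0 : ℝ) ≤ α)]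
    nlinarith
  have e2 : |(β : ℝ) * (z - round z)| * α < 1 := by
    rw [abs_mul, abs_of_nonneg (by positivity : (0 : ℝ) ≤ β)]
    nlinarith
  have f1 : |(α : ℝ) * (y - round y)| < 1 / 2 := by
    nlinarith [abs_nonneg ((α : ℝ) * (y - round y))]
  have f2 : |(β : ℝ) * (z - round z)| < 1 / 2 := by
    nlinarith [abs_nonneg ((β : ℝ) * (z - round z))]
  rw [abs_lt] at f1 f2
  have g1 : ((α : ℤ) * round y - β * round z : ℤ) < 1 := by
    have : (((α : ℤ) * round y - β * round z : ℤ) : ℝ) < ((1 : ℤ) : ℝ) := by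
      push_cast
      linarith [f1.1, f2.2]
    exact_mod_cast this
  have g2 : -1 < ((α : ℤ) * round y - β * round z : ℤ) := by
    have : ((-1 : ℤ) : ℝ) < (((α : ℤ) * round y - β * round z : ℤ) : ℝ) := by
      push_cast
      linarith [f1.2, f2.1]
    exact_mod_cast this
  omega

theorem aux_exists (α β : ℕ) (hco : Nat.Coprime α β) (hβ : 1 < β) (hαβ : β < α) (N : ℕ) :
    ∃ M : ℕ, ∀ x : ℝ, 1 ≤ x → x ≤ (α : ℝ) / (β : ℝ) →
      ∃ j, N ≤ j ∧ j ≤ M ∧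
        1 / ((α : ℝ) * (β : ℝ)) ≤ nint (((α : ℝ) / (β : ℝ)) ^ j * x) := by
  refine ⟨N + (α ^ (N + 1) + 1), fun x hx1 hx2 => ?_⟩
  by_contra! H
  have hb : (2 : ℝ) ≤ β := by exact_mod_cast hβ
  have hab : (β : ℝ) < α := by exact_mod_cast hαβ
  have hr1 : 1 ≤ (α : ℝ) / β := by
    rw [le_div_iff₀ (by linarith)]; linarith
  have hra : (α : ℝ) / β ≤ α := div_le_self (by linarith) (by linarith)
  have key : ∀ k, k ≤ α ^ (N + 1) + 1 →
      (α : ℤ) ^ k * round (((α : ℝ) / β) ^ N * x)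
        = (β : ℤ) ^ k * round (((α : ℝ) / β) ^ (N + k) * x) := by
    intro k
    induction k with
    | zero => intro _; simp
    | succ k ih =>
      intro hk
      have h := aux_step α β hβ hαβ (((α : ℝ) / β) ^ (N + k) * x)
        (((α : ℝ) / β) ^ (N + (k + 1)) * x) (by
          rw [← add_assoc, pow_succ]
          field_simp) (H (N + k) (by omega) (by omega)) (H (N + (k + 1)) (by omega) (by omega))
      have ih' := ih (by omega)
      rw [pow_succ, pow_succ]
      linear_combination (α : ℤ) * ih' + (β : ℤ) ^ k * h
  have hk := key _ le_rfl
  have hdvd : (β : ℤ) ^ (α ^ (N + 1) + 1) ∣ round (((α : ℝ) / β) ^ N * x) := by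
    have hc : IsCoprime ((β : ℤ) ^ (α ^ (N + 1) + 1)) ((α : ℤ) ^ (α ^ (N + 1) + 1)) :=
      (Nat.isCoprime_iff_coprime.mpr hco.symm).pow
    exact hc.dvd_of_dvd_mul_left ⟨_, hk⟩
  have hy1 : 1 ≤ ((α : ℝ) / β) ^ N * x := one_le_mul_of_one_le_of_one_le (one_le_pow₀ hr1) hx1
  have hy2 : ((α : ℝ) / β) ^ N * x ≤ (α : ℝ) ^ (N + 1) := by
    rw [pow_succ]
    gcongr
    linarith
  have ha := abs_le.mp (abs_sub_round (((α : ℝ) / β) ^ N * x))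
  have hpos : 0 < round (((α : ℝ) / β) ^ N * x) := by
    have : (0 : ℝ) < (round (((α : ℝ) / β) ^ N * x) : ℝ) := by linarith [ha.2]
    exact_mod_cast this
  have hle := Int.le_of_dvd hpos hdvd
  have hup : round (((α : ℝ) / β) ^ N * x) < (α : ℤ) ^ (N + 1) + 1 := by
    have : (round (((α : ℝ) / β) ^ N * x) : ℝ) < (α : ℝ) ^ (N + 1) + 1 := by linarith [ha.1]
    exact_mod_cast this
  have hlt : α ^ (N + 1) + 1 < β ^ (α ^ (N + 1) + 1) := Nat.lt_pow_self hβ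
  have hlt' : (α : ℤ) ^ (N + 1) + 1 < (β : ℤ) ^ (α ^ (N + 1) + 1) := by exact_mod_cast hlt
  linarith

/-- Lemma 4.4: for coprime integers `α > β > 1` there is a sequence `(q_n)` such
that for every `n ≥ 1` and every `x ∈ [1, α/β]`, at least `n` of the indices
`0 ≤ j ≤ q_n + 1` satisfy `‖(α/β)^j x‖ ≥ 1/(αβ)`. -/
theorem exists_sequence_many_indices_far_from_integers
    (α β : ℕ) (hco : Nat.Coprime α β) (hβ : 1 < β) (hαβ : β < α) :
    ∃ q : ℕ → ℕ, ∀ n : ℕ, 1 ≤ n → ∀ x : ℝ, 1 ≤ x → x ≤ (α : ℝ) / (β : ℝ) →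
      n ≤ {j : ℕ | j ≤ q n + 1 ∧
        1 / ((α : ℝ) * (β : ℝ)) ≤ nint (((α : ℝ) / (β : ℝ)) ^ j * x)}.ncard := by
  suffices h : ∀ n : ℕ, ∃ Q : ℕ, ∀ x : ℝ, 1 ≤ x → x ≤ (α : ℝ) / (β : ℝ) →
      n ≤ {j : ℕ | j ≤ Q + 1 ∧
        1 / ((α : ℝ) * (β : ℝ)) ≤ nint (((α : ℝ) / (β : ℝ)) ^ j * x)}.ncard by
    choose q hq using h
    exact ⟨q, fun n _ => hq n⟩
  intro n
  induction n with
  | zero => exact ⟨0, fun _ _ _ => Nat.zero_le _⟩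
  | succ n ih =>
    obtain ⟨Q, hQ⟩ := ih
    obtain ⟨M, hM⟩ := aux_exists α β hco hβ hαβ (Q + 2)
    refine ⟨M, fun x h1 h2 => ?_⟩
    obtain ⟨j, hj1, hj2, hj3⟩ := hM x h1 h2
    have hfin : ∀ R : ℕ, {j : ℕ | j ≤ R + 1 ∧
        1 / ((α : ℝ) * (β : ℝ)) ≤ nint (((α : ℝ) / (β : ℝ)) ^ j * x)}.Finite :=
      fun R => (Set.finite_Iic (R + 1)).subset fun i hi => hi.1
    have hnot : j ∉ {j : ℕ | j ≤ Q + 1 ∧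
        1 / ((α : ℝ) * (β : ℝ)) ≤ nint (((α : ℝ) / (β : ℝ)) ^ j * x)} := by
      intro h
      have := h.1
      omega
    have hcard := Set.ncard_insert_of_notMem hnot (hfin Q)
    refine le_trans (Nat.succ_le_succ (hQ x h1 h2)) ?_
    rw [Nat.succ_eq_add_one, ← hcard]
    refine Set.ncard_le_ncard ?_ (hfin M)
    intro i hi
    rcases hi with rfl | hi
    · exact ⟨by omega, hj3⟩
    · exact ⟨by have := hi.1; omega, hi.2⟩
end

section
/- Let α and β be coprime positive integers with α > β > 1, and let q₁ be the smallest positive integer such that ⌊α/β⌋ + 1 ≤ β^{q₁}. Then for every real x ∈ [1, α/β] there exists an index j with 0 ≤ j ≤ q₁ + 1 such that ‖(α/β)^j x‖ ≥ 1/(αβ), where ‖y‖ = dist(y, ℤ) denotes the distance from y to the nearest integer. -/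
/-- Base case of Lemma 4.4: with `q₁` the smallest positive integer such that
`⌊α/β⌋ + 1 ≤ β^{q₁}`, every `x ∈ [1, α/β]` admits an index `0 ≤ j ≤ q₁ + 1` with
`‖(α/β)^j x‖ ≥ 1/(αβ)`. -/
theorem exists_index_far_from_integers
    (α β : ℕ) (hco : Nat.Coprime α β) (hβ : 1 < β) (hαβ : β < α)
    (q1 : ℕ) (hq1pos : 0 < q1) (hq1 : α / β + 1 ≤ β ^ q1)
    (hq1min : ∀ m : ℕ, 0 < m → α / β + 1 ≤ β ^ m → q1 ≤ m) :
    ∀ x : ℝ, 1 ≤ x → x ≤ (α : ℝ) / (β : ℝ) →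
      ∃ j : ℕ, j ≤ q1 + 1 ∧
        1 / ((α : ℝ) * (β : ℝ)) ≤ nint (((α : ℝ) / (β : ℝ)) ^ j * x) := by
  intro x hx1 hx2
  by_contra hcon
  push Not at hcon
  have hb2 : (2 : ℝ) ≤ β := by exact_mod_cast hβ
  have ha3 : (3 : ℝ) ≤ α := by
    have : 3 ≤ α := by omega
    exact_mod_cast this
  have hb0 : (0 : ℝ) < β := by linarith
  have ha0 : (0 : ℝ) < α := by linarith
  have hab0 : (0 : ℝ) < (α : ℝ) * β := mul_pos ha0 hb0
  have hsmall : 1 / ((α : ℝ) * β) ≤ 1 / 6 := by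
    apply one_div_le_one_div_of_le (by norm_num)
    nlinarith
  set n : ℕ → ℤ := fun j => round (((α : ℝ) / β) ^ j * x) with hn
  have habs : ∀ j ≤ q1 + 1, |((α : ℝ) / β) ^ j * x - n j| < 1 / ((α : ℝ) * β) :=
    fun j hj => hcon j hj
  have hstep : ∀ j, j + 1 ≤ q1 + 1 → (β : ℤ) * n (j + 1) = α * n j := by
    intro j hj
    have h1 := abs_lt.1 (habs j (by omega))
    have h2 := abs_lt.1 (habs (j + 1) hj)
    have hy : (β : ℝ) * (((α : ℝ) / β) ^ (j + 1) * x) = α * (((α : ℝ) / β) ^ j * x) := by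
      rw [pow_succ]
      field_simp
    have e1 : (α : ℝ) * (1 / ((α : ℝ) * β)) ≤ 1 / 2 := by
      have : (α : ℝ) * (1 / ((α : ℝ) * β)) = 1 / β := by field_simp
      rw [this]
      exact one_div_le_one_div_of_le (by norm_num) hb2
    have e2 : (β : ℝ) * (1 / ((α : ℝ) * β)) ≤ 1 / 3 := by
      have : (β : ℝ) * (1 / ((α : ℝ) * β)) = 1 / α := by field_simp
      rw [this]
      exact one_div_le_one_div_of_le (by norm_num) ha3
    have a1 := mul_lt_mul_of_pos_left h1.1 ha0
    have a2 := mul_lt_mul_of_pos_left h1.2 ha0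
    have b1 := mul_lt_mul_of_pos_left h2.1 hb0
    have b2 := mul_lt_mul_of_pos_left h2.2 hb0
    have u1 : (β : ℝ) * n (j + 1) - α * n j < 1 := by linarith
    have u2 : -1 < (β : ℝ) * n (j + 1) - α * n j := by linarith
    have v1 : (β : ℤ) * n (j + 1) - α * n j < 1 := by exact_mod_cast u1
    have v2 : -1 < (β : ℤ) * n (j + 1) - α * n j := by exact_mod_cast u2
    omega
  have hpow : ∀ k, k ≤ q1 + 1 → (β : ℤ) ^ k * n k = (α : ℤ) ^ k * n 0 := by
    intro k
    induction k with
    | zero => intro _; simp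
    | succ k ih =>
      intro hk
      have h1 := ih (by omega)
      have h2 := hstep k hk
      calc (β : ℤ) ^ (k + 1) * n (k + 1) = (β : ℤ) ^ k * (β * n (k + 1)) := by ring
        _ = α * ((β : ℤ) ^ k * n k) := by rw [h2]; ring
        _ = (α : ℤ) ^ (k + 1) * n 0 := by rw [h1]; ring
  have hdvd : (β : ℤ) ^ (q1 + 1) ∣ n 0 := by
    have hc : IsCoprime ((β : ℤ) ^ (q1 + 1)) ((α : ℤ) ^ (q1 + 1)) :=
      (Nat.isCoprime_iff_coprime.2 hco.symm).pow
    exact hc.dvd_of_dvd_mul_left ⟨_, (hpow (q1 + 1) le_rfl).symm⟩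
  have h0 := abs_lt.1 (habs 0 (by omega))
  rw [pow_zero, one_mul] at h0
  have hn0 : 0 < n 0 := by
    have : (0 : ℝ) < n 0 := by linarith
    exact_mod_cast this
  have hle : (β : ℝ) ^ (q1 + 1) ≤ n 0 := by
    exact_mod_cast Int.le_of_dvd hn0 hdvd
  have hlt : (α : ℝ) / β < (β : ℝ) ^ q1 := by
    have h : α < β ^ q1 * β := by
      have : α / β < β ^ q1 := hq1
      exact (Nat.div_lt_iff_lt_mul (by omega)).1 this
    rw [div_lt_iff₀ hb0]
    exact_mod_cast h
  have hone : (1 : ℝ) ≤ (β : ℝ) ^ q1 := one_le_pow₀ (by linarith)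
  have : (β : ℝ) ^ (q1 + 1) = (β : ℝ) ^ q1 * β := pow_succ _ _
  nlinarith
end
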